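/- arXiv:2109.14043 — 12 statements merged into one kernel-verified Lean document; each statement's English description precedes it below -/
import Mathlib

section
/- Let M be a left R-module and N a submodule of M. For all submodules K, L of N, the product K_M L is contained in K_N L. Moreover, if N is a direct summand of M, then K_M L = K_N L. -/
open Function

universe u v

variable (R : Type u) [Ring R]

/-- The product `A ·_M B = Σ { f(A) ∣ f ∈ Hom_R(M, B) }` of two submodules of `M`. -/
def smulMod {M : Type v} [AddCommGroup M] [Module R M] (A B : Submodule R M) :
    Submodule R M :=
  ⨆ f : M →ₗ[R] ↥B, A.map (B.subtype ∘ₗ f)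

/-- Powers: `spowMod N k = N^(k+1)`, i.e. `N^1 = N`, `N^(ℓ+1) = N^ℓ ·_M N`. -/
def spowMod {M : Type v} [AddCommGroup M] [Module R M] (N : Submodule R M) :
    ℕ → Submodule R M
  | 0 => N
  | k + 1 => smulMod R (spowMod N k) N

/-- A submodule is nilpotent if some power of it (w.r.t. the product `·_M`) is zero. -/
def IsNilpotentSubmodule {M : Type v} [AddCommGroup M] [Module R M]
    (N : Submodule R M) : Prop :=
  ∃ k : ℕ, spowMod R N k = ⊥

/-- Left-associated product of a nonempty finite family of submodules. -/
def chainProd {M : Type v} [AddCommGroup M] [Module R M] :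
    {ℓ : ℕ} → (Fin (ℓ + 1) → Submodule R M) → Submodule R M
  | 0, A => A 0
  | ℓ + 1, A => smulMod R (chainProd fun i => A i.castSucc) (A (Fin.last (ℓ + 1)))

/-- `N` is a locally nilpotent submodule of `M`. -/
def IsLocallyNilpotentSubmodule {M : Type v} [AddCommGroup M] [Module R M]
    (N : Submodule R M) : Prop :=
  ∀ (k : ℕ) (n : Fin k → M), (∀ i, n i ∈ N) →
    ∃ ℓ : ℕ, ∀ idx : Fin (ℓ + 1) → Fin k,
      chainProd R (fun j => (R ∙ n (idx j) : Submodule R M)) = ⊥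

/-- `N` is a nil-submodule of `M`: every `f : M → Rn` with `n ∈ N` is nilpotent. -/
def IsNilSubmodule {M : Type v} [AddCommGroup M] [Module R M]
    (N : Submodule R M) : Prop :=
  ∀ n ∈ N, ∀ f : Module.End R M, LinearMap.range f ≤ (R ∙ n) → IsNilpotent f

def IsFullyInvariant {M : Type v} [AddCommGroup M] [Module R M]
    (N : Submodule R M) : Prop :=
  ∀ f : Module.End R M, N.map f ≤ N

def IsPrimeSubmodule {M : Type v} [AddCommGroup M] [Module R M]
    (P : Submodule R M) : Prop :=
  IsFullyInvariant R P ∧ P ≠ ⊤ ∧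
    ∀ A B : Submodule R M, IsFullyInvariant R A → IsFullyInvariant R B →
      smulMod R A B ≤ P → A ≤ P ∨ B ≤ P

def IsSemiprimeSubmodule {M : Type v} [AddCommGroup M] [Module R M]
    (P : Submodule R M) : Prop :=
  IsFullyInvariant R P ∧
    ∀ A : Submodule R M, IsFullyInvariant R A → smulMod R A A ≤ P → A ≤ P

/-- The prime radical of `M`: the intersection of all prime submodules. -/
def primeRadical (M : Type v) [AddCommGroup M] [Module R M] : Submodule R M :=
  sInf {P : Submodule R M | IsPrimeSubmodule R P}

/-- `𝔏(M)`: the sum of all locally nilpotent submodules of `M`. -/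
def locNilRad (M : Type v) [AddCommGroup M] [Module R M] : Submodule R M :=
  sSup {N : Submodule R M | IsLocallyNilpotentSubmodule R N}

/-- `M` is quasi-projective (`M`-projective). -/
def IsQuasiProjective (M : Type v) [AddCommGroup M] [Module R M] : Prop :=
  ∀ (K : Submodule R M) (g : M →ₗ[R] M ⧸ K), ∃ h : M →ₗ[R] M, K.mkQ ∘ₗ h = g

/-- `M` is `M^(Λ)`-projective for every index set `Λ`. -/
def IsDirSumSelfProjective (M : Type v) [AddCommGroup M] [Module R M] : Prop :=
  ∀ (ι : Type v) (K : Submodule R (ι →₀ M)) (g : M →ₗ[R] (ι →₀ M) ⧸ K),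
    ∃ h : M →ₗ[R] (ι →₀ M), K.mkQ ∘ₗ h = g

/-- `ann_M(N) = ⋂ { Ker f ∣ f ∈ Hom_R(M, N) }`. -/
def annIn {M : Type v} [AddCommGroup M] [Module R M] (N : Submodule R M) :
    Submodule R M :=
  ⨅ f : M →ₗ[R] ↥N, LinearMap.ker f

/-- `ann_M^r(N) = Σ { K ≤ M ∣ N ·_M K = 0 }`. -/
def rannIn {M : Type v} [AddCommGroup M] [Module R M] (N : Submodule R M) :
    Submodule R M :=
  sSup {K : Submodule R M | smulMod R N K = ⊥}

/-- `M` is retractable: `Hom_R(M, K) ≠ 0` for every nonzero `K ≤ M`. -/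
def IsRetractable (M : Type v) [AddCommGroup M] [Module R M] : Prop :=
  ∀ K : Submodule R M, K ≠ ⊥ → ∃ f : M →ₗ[R] ↥K, f ≠ 0

/-- `⋂_{f ∈ Y} Ker f` for a set `Y` of endomorphisms. -/
def kerInt {M : Type v} [AddCommGroup M] [Module R M]
    (Y : Set (Module.End R M)) : Submodule R M :=
  ⨅ f ∈ Y, LinearMap.ker f

/-- `M` satisfies the acc on annihilators. -/
def AccOnAnnihilators (M : Type v) [AddCommGroup M] [Module R M] : Prop :=
  ∀ c : ℕ → Set (Module.End R M),
    (∀ i, kerInt R (c i) ≤ kerInt R (c (i + 1))) →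
      ∃ n : ℕ, ∀ m : ℕ, n ≤ m → kerInt R (c m) = kerInt R (c n)

/-- `M` has finite uniform dimension: there is no infinite independent family of
nonzero submodules. -/
def FiniteUniformDimension (M : Type v) [AddCommGroup M] [Module R M] : Prop :=
  ¬ ∃ f : ℕ → Submodule R M, iSupIndep f ∧ ∀ i, f i ≠ ⊥

/-- `M` is a Goldie module. -/
def IsGoldieModule (M : Type v) [AddCommGroup M] [Module R M] : Prop :=
  AccOnAnnihilators R M ∧ FiniteUniformDimension R M

theorem product_in_submodule {M : Type v} [AddCommGroup M] [Module R M]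
    (N K L : Submodule R M) (hK : K ≤ N) (hL : L ≤ N) :
    smulMod R K L ≤
      (smulMod R (K.comap N.subtype) (L.comap N.subtype)).map N.subtype ∧
    ((∃ N' : Submodule R M, IsCompl N N') →
      smulMod R K L =
        (smulMod R (K.comap N.subtype) (L.comap N.subtype)).map N.subtype) := by
  have h1 : smulMod R K L ≤
      (smulMod R (K.comap N.subtype) (L.comap N.subtype)).map N.subtype := by
    unfold smulMod
    refine iSup_le fun f => ?_
    rintro _ ⟨x, hx, rfl⟩
    let g : ↥N →ₗ[R] ↥(L.comap N.subtype) :=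
      LinearMap.codRestrict _
        (LinearMap.codRestrict N (L.subtype ∘ₗ f ∘ₗ N.subtype) (fun y => hL (f y).2))
        (fun y => (f y).2)
    refine ⟨(g ⟨x, hK hx⟩ : ↥N), ?_, rfl⟩
    exact Submodule.mem_iSup_of_mem g ⟨⟨x, hK hx⟩, hx, rfl⟩
  refine ⟨h1, ?_⟩
  rintro ⟨N', hN⟩
  refine le_antisymm h1 ?_
  unfold smulMod
  rw [Submodule.map_iSup]
  refine iSup_le fun g => ?_
  rintro _ ⟨_, ⟨x, hx, rfl⟩, rfl⟩
  let f : M →ₗ[R] ↥L :=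
    LinearMap.codRestrict L
      (N.subtype ∘ₗ (L.comap N.subtype).subtype ∘ₗ g ∘ₗ N.linearProjOfIsCompl N' hN)
      (fun y => (g (N.linearProjOfIsCompl N' hN y)).2)
  refine Submodule.mem_iSup_of_mem f ⟨(x : M), hx, ?_⟩
  have hp : N.linearProjOfIsCompl N' hN (x : M) = x :=
    Submodule.linearProjOfIsCompl_apply_left hN x
  change (((g (N.linearProjOfIsCompl N' hN (x : M)) : ↥N)) : M) = ((g x : ↥N) : M)
  rw [hp]
end

section
/- Let M be a quasi-projective left R-module, A and B submodules of M, and f an endomorphism of M. Then f(A_M B) = A_M f(B) and f(A)_M B ⊆ A_M B. -/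
open Function

universe u v

variable (R : Type u) [Ring R]

theorem lift_through_submoduleMap {M : Type v} [AddCommGroup M] [Module R M]
    (hqp : IsQuasiProjective R M) (B : Submodule R M) (f : Module.End R M)
    (g : M →ₗ[R] ↥(B.map f)) : ∃ h : M →ₗ[R] ↥B, ∀ m, f (h m : M) = (g m : M) := by
  let φ : ↥B →ₗ[R] ↥(B.map f) := f.submoduleMap B
  have hφ : Surjective φ := f.submoduleMap_surjective B
  let e := φ.quotKerEquivOfSurjective hφ
  let K : Submodule R M := (LinearMap.ker φ).map B.subtype
  let j := (LinearMap.ker φ).mapQ K B.subtype (Submodule.le_comap_map _ _)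
  obtain ⟨h, hh⟩ := hqp K (j ∘ₗ e.symm.toLinearMap ∘ₗ g)
  have key : ∀ m, ∃ b : ↥B, (b : M) = h m ∧ f (b : M) = (g m : M) := by
    intro m
    obtain ⟨b, hb⟩ := hφ (g m)
    have h1 : e.symm (g m) = (LinearMap.ker φ).mkQ b := by
      rw [LinearEquiv.symm_apply_eq, ← hb]
      rfl
    have h2 : K.mkQ (h m) = K.mkQ (b : M) := by
      have := LinearMap.congr_fun hh m
      simp only [LinearMap.comp_apply, LinearEquiv.coe_coe] at this
      rw [this, h1]
      rfl
    have h3 : h m - b ∈ K := (Submodule.Quotient.eq K).1 h2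
    obtain ⟨c, hc, hc2⟩ := h3
    have hc' : f (c : M) = 0 := congrArg Subtype.val (LinearMap.mem_ker.1 hc)
    have hb' : f (b : M) = (g m : M) := congrArg Subtype.val hb
    have hc3 : (c : M) = h m - b := hc2
    refine ⟨c + b, ?_, ?_⟩
    · rw [Submodule.coe_add, hc3, sub_add_cancel]
    · rw [Submodule.coe_add, map_add, hc', hb', zero_add]
  refine ⟨h.codRestrict B fun m => ?_, fun m => ?_⟩
  · obtain ⟨b, hb, -⟩ := key m
    exact hb ▸ b.2
  · obtain ⟨b, hb, hb2⟩ := key m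
    rw [LinearMap.codRestrict_apply, ← hb, hb2]

theorem smulMod_map_endomorphism {M : Type v} [AddCommGroup M] [Module R M]
    (hqp : IsQuasiProjective R M) (A B : Submodule R M) (f : Module.End R M) :
    (smulMod R A B).map f = smulMod R A (B.map f) ∧
    smulMod R (A.map f) B ≤ smulMod R A B := by
  refine ⟨le_antisymm ?_ ?_, ?_⟩
  · unfold smulMod
    rw [Submodule.map_iSup]
    refine iSup_le fun g => ?_
    refine le_trans ?_ (le_iSup _ (f.submoduleMap B ∘ₗ g))
    rintro _ ⟨_, ⟨a, ha, rfl⟩, rfl⟩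
    exact ⟨a, ha, rfl⟩
  · unfold smulMod
    rw [Submodule.map_iSup]
    refine iSup_le fun g => ?_
    obtain ⟨h, hh⟩ := lift_through_submoduleMap R hqp B f g
    refine le_trans ?_ (le_iSup _ h)
    rintro _ ⟨a, ha, rfl⟩
    exact ⟨_, ⟨a, ha, rfl⟩, hh a⟩
  · unfold smulMod
    refine iSup_le fun g => ?_
    refine le_trans ?_ (le_iSup _ (g ∘ₗ f))
    rintro _ ⟨_, ⟨a, ha, rfl⟩, rfl⟩
    exact ⟨a, ha, rfl⟩
end

section
/- Let M be a quasi-projective module and K, N submodules of M with K fully invariant in M. If π: M → M/K is the canonical projection, then π(N_M N) = π(N)_{M/K} π(N). -/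
open Function

universe u v

variable (R : Type u) [Ring R]

theorem smulMod_map_quotient {M : Type v} [AddCommGroup M] [Module R M]
    (hqp : IsQuasiProjective R M) (K N : Submodule R M)
    (hK : IsFullyInvariant R K) :
    (smulMod R N N).map K.mkQ = smulMod R (N.map K.mkQ) (N.map K.mkQ) := by
  have aux : ∃ s : ↥(N.map K.mkQ) →ₗ[R] M ⧸ (N ⊓ K),
      ∀ (n : M) (hn : n ∈ N), s ⟨K.mkQ n, Submodule.mem_map_of_mem hn⟩ = (N ⊓ K).mkQ n := by
    let q : ↥N →ₗ[R] ↥(N.map K.mkQ) :=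
      K.mkQ.restrict (p := N) (q := N.map K.mkQ) (fun n hn => Submodule.mem_map_of_mem hn)
    have hq : Function.Surjective q := by
      rintro ⟨_, n, hn, rfl⟩
      exact ⟨⟨n, hn⟩, rfl⟩
    have hker : LinearMap.ker q ≤ LinearMap.ker ((N ⊓ K).mkQ ∘ₗ N.subtype) := by
      rintro ⟨n, hn⟩ h
      have h1 : K.mkQ n = 0 := congrArg Subtype.val (LinearMap.mem_ker.mp h)
      have h2 : n ∈ K := by simpa using h1
      simp [hn, h2]
    refine ⟨(LinearMap.ker q).liftQ _ hker ∘ₗ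
      (q.quotKerEquivOfSurjective hq).symm.toLinearMap, fun n hn => ?_⟩
    have h3 : (q.quotKerEquivOfSurjective hq).symm ⟨K.mkQ n, Submodule.mem_map_of_mem hn⟩
        = (LinearMap.ker q).mkQ ⟨n, hn⟩ := by
      rw [LinearEquiv.symm_apply_eq]
      rfl
    rw [LinearMap.comp_apply, LinearEquiv.coe_coe, h3]
    rfl
  obtain ⟨s, hs⟩ := aux
  unfold smulMod
  apply le_antisymm
  · rw [Submodule.map_iSup]
    refine iSup_le fun f => ?_
    let q : ↥N →ₗ[R] ↥(N.map K.mkQ) :=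
      K.mkQ.restrict (p := N) (q := N.map K.mkQ) (fun n hn => Submodule.mem_map_of_mem hn)
    have hle : K ≤ LinearMap.ker (q ∘ₗ f) := by
      intro k hk
      rw [LinearMap.mem_ker]
      apply Subtype.ext
      have : (f k : M) ∈ K := hK (N.subtype ∘ₗ f) ⟨k, hk, rfl⟩
      change K.mkQ (f k : M) = 0
      simpa using this
    refine le_trans ?_ (le_iSup _ (K.liftQ (q ∘ₗ f) hle))
    rintro _ ⟨_, ⟨n, hn, rfl⟩, rfl⟩
    exact ⟨K.mkQ n, Submodule.mem_map_of_mem hn, rfl⟩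
  · refine iSup_le fun g => ?_
    obtain ⟨h, hh⟩ := hqp (N ⊓ K) (s ∘ₗ g ∘ₗ K.mkQ)
    have key : ∀ m, h m ∈ N ∧ K.mkQ (h m) = (g (K.mkQ m) : M ⧸ K) := by
      intro m
      obtain ⟨n, hn, hgn⟩ := (g (K.mkQ m)).2
      have h1 : (N ⊓ K).mkQ (h m) = (N ⊓ K).mkQ n := by
        rw [← hs n hn]
        refine (LinearMap.congr_fun hh m).trans ?_
        exact congrArg s (Subtype.ext hgn.symm)
      have h2 : h m - n ∈ N ⊓ K := (Submodule.Quotient.eq _).mp h1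
      refine ⟨by simpa using N.add_mem h2.1 hn, ?_⟩
      rw [← hgn]
      exact (Submodule.Quotient.eq _).mpr h2.2
    rintro _ ⟨_, ⟨n, hn, rfl⟩, rfl⟩
    refine ⟨h n, ?_, (key n).2⟩
    exact Submodule.mem_iSup_of_mem (h.codRestrict N fun m => (key m).1) ⟨n, hn, rfl⟩
end

section
/- Let M be a quasi-projective module and N a nil-submodule of M. Then for every submodule K ≤ M, the submodule (N+K)/K is a nil-submodule of M/K. -/
open Function

universe u v

variable (R : Type u) [Ring R]

theorem nilSubmodule_quotient {M : Type v} [AddCommGroup M] [Module R M]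
    (hqp : IsQuasiProjective R M) (N : Submodule R M)
    (hN : IsNilSubmodule R N) (K : Submodule R M) :
    IsNilSubmodule R ((N ⊔ K).map K.mkQ) := by
  intro x hx f hf
  obtain ⟨n, hn, rfl⟩ : ∃ n ∈ N, K.mkQ n = x := by
    obtain ⟨y, hy, rfl⟩ := hx
    obtain ⟨a, ha, b, hb, rfl⟩ := Submodule.mem_sup.1 hy
    refine ⟨a, ha, ?_⟩
    have : K.mkQ b = 0 := by simpa using hb
    rw [map_add, this, add_zero]
  let P : Submodule R M := R ∙ n
  let L : Submodule R M := P ⊓ K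
  let φ : P →ₗ[R] M ⧸ L := L.mkQ ∘ₗ P.subtype
  let ψ : P →ₗ[R] M ⧸ K := K.mkQ ∘ₗ P.subtype
  have hker : LinearMap.ker ψ ≤ LinearMap.ker φ := by
    intro y hy
    have hy' : (y : M) ∈ K := by simpa [ψ] using hy
    have : (y : M) ∈ L := ⟨y.2, hy'⟩
    simpa [φ] using this
  have hr : ∀ m : M, (f ∘ₗ K.mkQ) m ∈ LinearMap.range ψ := by
    intro m
    have h1 : f (K.mkQ m) ∈ (R ∙ K.mkQ n) := hf ⟨_, rfl⟩
    obtain ⟨r, hr⟩ := Submodule.mem_span_singleton.1 h1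
    refine ⟨⟨r • n, Submodule.smul_mem _ _ (Submodule.mem_span_singleton_self n)⟩, ?_⟩
    change K.mkQ (r • n) = f (K.mkQ m)
    rw [map_smul, hr]
  let c : M →ₗ[R] LinearMap.range ψ := (f ∘ₗ K.mkQ).codRestrict _ hr
  let g : M →ₗ[R] M ⧸ L :=
    (LinearMap.ker ψ).liftQ φ hker ∘ₗ ψ.quotKerEquivRange.symm.toLinearMap ∘ₗ c
  obtain ⟨h, hh⟩ := hqp L g
  have key : ∀ m, h m ∈ P ∧ K.mkQ (h m) = f (K.mkQ m) := by
    intro m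
    obtain ⟨y, hy⟩ := hr m
    have hc : c m = ψ.quotKerEquivRange (Submodule.Quotient.mk y) := by
      apply Subtype.ext
      rw [LinearMap.quotKerEquivRange_apply_mk]
      exact hy.symm
    have hg : g m = φ y := by
      change (LinearMap.ker ψ).liftQ φ hker (ψ.quotKerEquivRange.symm (c m)) = _
      rw [hc, LinearEquiv.symm_apply_apply]
      exact Submodule.liftQ_apply _ _ _
    have h2 : L.mkQ (h m) = L.mkQ (y : M) := (LinearMap.congr_fun hh m).trans hg
    have h3 : h m - y ∈ L := (Submodule.Quotient.eq L).1 h2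
    constructor
    · have := P.add_mem h3.1 y.2
      simpa using this
    · exact ((Submodule.Quotient.eq K).2 h3.2).trans hy
  obtain ⟨k, hk⟩ := hN n hn h (by rintro _ ⟨m, rfl⟩; exact (key m).1)
  refine ⟨k, ?_⟩
  have hpow : ∀ (j : ℕ) (m : M), (f ^ j) (K.mkQ m) = K.mkQ ((h ^ j) m) := by
    intro j
    induction j with
    | zero => intro m; rfl
    | succ j ih =>
      intro m
      rw [pow_succ, pow_succ, Module.End.mul_apply, Module.End.mul_apply, ← (key m).2, ih]
  ext m
  change (f ^ k) (K.mkQ m) = 0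
  rw [hpow, hk, LinearMap.zero_apply, map_zero]
end

section
/- Suppose M is M^(Λ)-projective for every index set Λ. If N is a finitely generated locally nilpotent submodule of M, then N is nilpotent. -/
open Function

universe u v

variable (R : Type u) [Ring R]

theorem aux_mem_smul {M : Type v} [AddCommGroup M] [Module R M] (A B : Submodule R M)
    (f : M →ₗ[R] M) (hf : ∀ m, f m ∈ B) {a : M} (ha : a ∈ A) : f a ∈ smulMod R A B := by
  have h := le_iSup (fun f : M →ₗ[R] ↥B => A.map (B.subtype ∘ₗ f)) (f.codRestrict B hf)
  exact h ⟨a, ha, rfl⟩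

theorem aux_smul_iSup {M : Type v} [AddCommGroup M] [Module R M]
    (hproj : IsDirSumSelfProjective R M) (ι : Type v) (A : Submodule R M)
    (B : ι → Submodule R M) :
    smulMod R A (⨆ i, B i) ≤ ⨆ i, smulMod R A (B i) := by
  classical
  refine iSup_le fun f => ?_
  rintro _ ⟨a, ha, rfl⟩
  let S : (ι →₀ M) →ₗ[R] M := Finsupp.lsum ℕ (fun _ => LinearMap.id)
  let B' : Submodule R (ι →₀ M) :=
    ⨅ i, (B i).comap (Finsupp.lapply i)
  have hB' : ∀ x, x ∈ B' ↔ ∀ i, x i ∈ B i := by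
    intro x; simp [B', Submodule.mem_iInf]
  let K := B' ⊓ LinearMap.ker S
  have hs : ∀ m : M, ∃ x : ι →₀ M, x ∈ B' ∧ S x = (f m : M) := by
    intro m
    obtain ⟨x, hx, hx2⟩ := (Submodule.mem_iSup_iff_exists_finsupp B _).1 (f m).2
    exact ⟨x, (hB' x).2 hx, hx2⟩
  choose s hs1 hs2 using hs
  let g : M →ₗ[R] (ι →₀ M) ⧸ K :=
    { toFun := fun m => K.mkQ (s m)
      map_add' := fun x y => by
        rw [← map_add, ← sub_eq_zero, ← map_sub, Submodule.mkQ_apply,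
          Submodule.Quotient.mk_eq_zero]
        refine ⟨B'.sub_mem (hs1 _) (B'.add_mem (hs1 _) (hs1 _)), ?_⟩
        simp [LinearMap.mem_ker, hs2]
      map_smul' := fun r x => by
        rw [RingHom.id_apply, ← map_smul, ← sub_eq_zero, ← map_sub, Submodule.mkQ_apply,
          Submodule.Quotient.mk_eq_zero]
        refine ⟨B'.sub_mem (hs1 _) (B'.smul_mem _ (hs1 _)), ?_⟩
        simp [LinearMap.mem_ker, hs2] }
  obtain ⟨h, hh⟩ := hproj ι K g
  have hK : ∀ m, h m - s m ∈ K := by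
    intro m
    have := LinearMap.congr_fun hh m
    rw [← Submodule.Quotient.mk_eq_zero, Submodule.Quotient.mk_sub, sub_eq_zero]
    exact this
  have h1 : ∀ m, h m ∈ B' := fun m => by
    have := B'.add_mem (hK m).1 (hs1 m)
    simpa using this
  have h2 : ∀ m, S (h m) = f m := fun m => by
    have := (hK m).2
    rw [SetLike.mem_coe, LinearMap.mem_ker, map_sub, sub_eq_zero] at this
    rw [this, hs2]
  change (f a : M) ∈ _
  rw [← h2 a]
  simp only [S, Finsupp.lsum_apply, Finsupp.sum]
  refine Submodule.sum_mem _ fun i _ => ?_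
  refine Submodule.mem_iSup_of_mem i ?_
  exact aux_mem_smul R A (B i) (Finsupp.lapply i ∘ₗ h) (fun m => (hB' _).1 (h1 m) i) ha

theorem aux_iSup_smul {M : Type v} [AddCommGroup M] [Module R M] {κ : Type*}
    (A : κ → Submodule R M) (B : Submodule R M) :
    smulMod R (⨆ j, A j) B = ⨆ j, smulMod R (A j) B := by
  simp only [smulMod, Submodule.map_iSup]
  exact iSup_comm

theorem aux_mono {M : Type v} [AddCommGroup M] [Module R M]
    {A A' : Submodule R M} (h : A ≤ A') (B : Submodule R M) :
    smulMod R A B ≤ smulMod R A' B :=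
  iSup_mono fun _ => Submodule.map_mono h

theorem aux_pow {M : Type v} [AddCommGroup M] [Module R M]
    (hproj : IsDirSumSelfProjective R M) {k : ℕ} (C : Fin k → Submodule R M) (l : ℕ) :
    spowMod R (⨆ i, C i) l ≤
      ⨆ idx : Fin (l + 1) → Fin k, chainProd R (fun j => C (idx j)) := by
  induction l with
  | zero => exact iSup_le fun i => le_iSup_of_le (fun _ => i) le_rfl
  | succ l ih =>
    refine (aux_mono R ih _).trans ?_
    rw [aux_iSup_smul]
    refine iSup_le fun idx => ?_
    rw [← Equiv.ulift.{v}.iSup_comp (g := C)]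
    refine (aux_smul_iSup R hproj _ _ _).trans (iSup_le fun i => ?_)
    refine le_iSup_of_le (Fin.snoc (α := fun _ => Fin k) idx i.down) ?_
    simp [chainProd]

theorem fg_locallyNilpotent_isNilpotent {M : Type v} [AddCommGroup M] [Module R M]
    (hproj : IsDirSumSelfProjective R M) (N : Submodule R M) (hfg : N.FG)
    (hN : IsLocallyNilpotentSubmodule R N) :
    IsNilpotentSubmodule R N := by
  obtain ⟨k, n, rfl⟩ := Submodule.fg_iff_exists_fin_generating_family.1 hfg
  obtain ⟨l, hl⟩ := hN k n fun i => Submodule.subset_span ⟨i, rfl⟩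
  refine ⟨l, ?_⟩
  rw [eq_bot_iff, Submodule.span_range_eq_iSup]
  refine (aux_pow R hproj _ l).trans (iSup_le fun idx => ?_)
  exact (hl idx).le
end

section
/- Suppose M is M^(Λ)-projective for every index set Λ. If N and L are locally nilpotent submodules of M, then N + L is locally nilpotent. -/
open Function

universe u v

variable (R : Type u) [Ring R]

/-- Endomorphisms of `M` whose range lies in `X`. -/
def homInto {M : Type v} [AddCommGroup M] [Module R M] (X : Submodule R M) :
    Submodule ℤ (Module.End R M) where
  carrier := {f | ∀ m, f m ∈ X}
  add_mem' := fun hf hg m => X.add_mem (hf m) (hg m)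
  zero_mem' := fun _ => X.zero_mem
  smul_mem' := fun c f hf m => by
    rw [LinearMap.smul_apply]
    exact zsmul_mem (hf m) c

theorem mem_homInto {M : Type v} [AddCommGroup M] [Module R M] {X : Submodule R M}
    {f : Module.End R M} : f ∈ homInto R X ↔ ∀ m, f m ∈ X := Iff.rfl

theorem homInto_mono {M : Type v} [AddCommGroup M] [Module R M] {X Y : Submodule R M}
    (h : X ≤ Y) : homInto R X ≤ homInto R Y := fun _ hf m => h (hf m)

theorem homInto_bot {M : Type v} [AddCommGroup M] [Module R M] :
    homInto R (⊥ : Submodule R M) = ⊥ := by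
  rw [eq_bot_iff]
  intro f hf
  rw [Submodule.mem_bot]
  ext m
  exact (Submodule.mem_bot R).1 (hf m)

theorem homInto_mul_top {M : Type v} [AddCommGroup M] [Module R M] (X : Submodule R M) :
    homInto R X * ⊤ ≤ homInto R X := by
  rw [Submodule.mul_le]
  intro f hf g _ m
  exact hf (g m)

theorem homInto_mul {M : Type v} [AddCommGroup M] [Module R M] (X Y : Submodule R M) :
    homInto R Y * homInto R X ≤ homInto R (smulMod R X Y) := by
  rw [Submodule.mul_le]
  intro g hg f hf m
  have h1 : X.map (Y.subtype ∘ₗ (LinearMap.codRestrict Y g hg)) ≤ smulMod R X Y :=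
    le_iSup (fun f : M →ₗ[R] ↥Y => X.map (Y.subtype ∘ₗ f)) _
  exact h1 ⟨f m, hf m, rfl⟩

theorem homInto_iSup {M : Type v} [AddCommGroup M] [Module R M]
    (hproj : IsDirSumSelfProjective R M) {ι : Type v} [Fintype ι] (X : ι → Submodule R M) :
    homInto R (⨆ i, X i) ≤ ⨆ i, homInto R (X i) := by
  classical
  intro g hg
  let D : Submodule R (ι →₀ M) := ⨅ i, (X i).comap (Finsupp.lapply i)
  have memD : ∀ d, d ∈ D ↔ ∀ i, d i ∈ X i := by
    intro d
    simp [D, Submodule.mem_iInf]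
  let S : (ι →₀ M) →ₗ[R] M := ∑ i, Finsupp.lapply i
  have hS : ∀ d, S d = ∑ i, d i := by
    intro d
    simp [S]
  let s : D →ₗ[R] M := S ∘ₗ D.subtype
  have hr : ∀ m, g m ∈ LinearMap.range s := by
    intro m
    obtain ⟨d, hd, hsum⟩ := (Submodule.mem_iSup_iff_exists_finsupp X (g m)).1 (hg m)
    refine ⟨⟨d, (memD d).2 hd⟩, ?_⟩
    change S d = g m
    rw [hS, ← hsum, Finsupp.sum_fintype _ _ (fun _ => rfl)]
  let K : Submodule R (ι →₀ M) := (LinearMap.ker s).map D.subtype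
  let q : (D ⧸ LinearMap.ker s) →ₗ[R] ((ι →₀ M) ⧸ K) :=
    Submodule.mapQ (LinearMap.ker s) K D.subtype (Submodule.le_comap_map _ _)
  obtain ⟨h, hh⟩ := hproj ι K
    (q ∘ₗ s.quotKerEquivRange.symm.toLinearMap ∘ₗ LinearMap.codRestrict (LinearMap.range s) g hr)
  have key : ∀ m, h m ∈ D ∧ S (h m) = g m := by
    intro m
    obtain ⟨d, hd⟩ := hr m
    have e1 : s.quotKerEquivRange.symm (LinearMap.codRestrict (LinearMap.range s) g hr m)
        = (LinearMap.ker s).mkQ d := by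
      rw [LinearEquiv.symm_apply_eq]
      apply Subtype.ext
      exact hd.symm
    have e2 : K.mkQ (h m) = K.mkQ (d : ι →₀ M) := by
      have := LinearMap.congr_fun hh m
      simp only [LinearMap.comp_apply, LinearEquiv.coe_coe] at this
      rw [e1] at this
      exact this
    have e3 : h m - d ∈ K := (Submodule.Quotient.eq K).1 e2
    obtain ⟨x, hx, hx2⟩ := e3
    have e4 : h m = (x : ι →₀ M) + d := by
      exact sub_eq_iff_eq_add.1 hx2.symm
    have hx' : S (x : ι →₀ M) = 0 := hx
    have hd' : S (d : ι →₀ M) = g m := hd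
    rw [e4]
    exact ⟨D.add_mem x.2 d.2, by rw [map_add, hx', hd', zero_add]⟩
  have hg' : g = ∑ i, (Finsupp.lapply i ∘ₗ h : M →ₗ[R] M) := by
    ext m
    rw [← (key m).2, hS]
    simp
  rw [hg']
  refine Submodule.sum_mem _ fun i _ => ?_
  exact Submodule.mem_iSup_of_mem i (fun m => (memD _).1 (key m).1 i)

theorem homInto_iSup_fin {M : Type v} [AddCommGroup M] [Module R M]
    (hproj : IsDirSumSelfProjective R M) {k : ℕ} (X : Fin k → Submodule R M) :
    homInto R (⨆ i, X i) ≤ ⨆ i, homInto R (X i) := by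
  have h := homInto_iSup R hproj (fun i : ULift.{v} (Fin k) => X i.down)
  refine le_trans (homInto_mono R ?_) (h.trans ?_)
  · exact iSup_le fun i => le_iSup (fun i : ULift.{v} (Fin k) => X i.down) ⟨i⟩
  · exact iSup_le fun i => le_iSup (fun i => homInto R (X i)) i.down

theorem homInto_sup {M : Type v} [AddCommGroup M] [Module R M]
    (hproj : IsDirSumSelfProjective R M) (X Y : Submodule R M) :
    homInto R (X ⊔ Y) ≤ homInto R X ⊔ homInto R Y := by
  have h := homInto_iSup_fin R hproj ![X, Y]
  refine le_trans (homInto_mono R ?_) (h.trans ?_)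
  · exact sup_le (le_iSup ![X, Y] 0) (le_iSup ![X, Y] 1)
  · refine iSup_le fun i => ?_
    fin_cases i
    · exact le_sup_left
    · exact le_sup_right

theorem homInto_pow_le {M : Type v} [AddCommGroup M] [Module R M]
    (hproj : IsDirSumSelfProjective R M) {k : ℕ} (X : Fin k → Submodule R M) (n : ℕ) :
    homInto R (⨆ i, X i) ^ (n + 1) ≤
      ⨆ idx : Fin (n + 1) → Fin k, homInto R (chainProd R fun j => X (idx j)) := by
  induction n with
  | zero =>
    refine (le_of_eq (pow_one _)).trans ?_
    refine (homInto_iSup_fin R hproj X).trans (iSup_le fun i => ?_)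
    exact le_iSup (fun idx : Fin (0 + 1) → Fin k =>
      homInto R (chainProd R fun j => X (idx j))) (fun _ => i)
  | succ n ih =>
    rw [pow_succ']
    refine (mul_le_mul' (homInto_iSup_fin R hproj X) ih).trans ?_
    rw [Submodule.iSup_mul]
    refine iSup_le fun i => ?_
    rw [Submodule.mul_iSup]
    refine iSup_le fun idx => ?_
    refine (homInto_mul R _ _).trans ?_
    refine le_trans (le_of_eq ?_) (le_iSup (fun idx : Fin (n + 1 + 1) → Fin k =>
      homInto R (chainProd R fun j => X (idx j))) (Fin.snoc (α := fun _ => Fin k) idx i))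
    simp [chainProd]

theorem chainProd_le {M : Type v} [AddCommGroup M] [Module R M] (C : Submodule R M) (n : ℕ)
    (X : Fin (n + 1) → Submodule R M) (hX : ∀ j, X j ≤ C) :
    chainProd R X ≤ ⨆ f : ↥(homInto R C ^ n), (⊤ : Submodule R M).map f.1 := by
  induction n with
  | zero =>
    refine le_trans ?_ (le_iSup (fun f : ↥(homInto R C ^ 0) => (⊤ : Submodule R M).map f.1)
      ⟨1, by rw [pow_zero]; exact Submodule.one_le.1 le_rfl⟩)
    intro x _
    exact ⟨x, trivial, rfl⟩
  | succ n ih =>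
    refine iSup_le fun g => ?_
    refine (Submodule.map_mono (ih _ fun j => hX _)).trans ?_
    rw [Submodule.map_iSup]
    refine iSup_le fun f => ?_
    let g' : Module.End R M := (X (Fin.last (n + 1))).subtype ∘ₗ g
    have hg' : g' ∈ homInto R C := fun m => hX _ (g m).2
    have hm : g' * f.1 ∈ homInto R C ^ (n + 1) := by
      rw [pow_succ']
      exact Submodule.mul_mem_mul hg' f.2
    refine le_trans (le_of_eq ?_)
      (le_iSup (fun f : ↥(homInto R C ^ (n + 1)) => (⊤ : Submodule R M).map f.1) ⟨g' * f.1, hm⟩)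
    exact (Submodule.map_comp _ _ _).symm

theorem pow_sup_eq_bot {S : Type*} [Ring S] (I J : Submodule ℤ S) (hI : I * ⊤ ≤ I)
    (p q : ℕ) (hp : I ^ p = ⊥) (hq : J ^ q = ⊥) : (I ⊔ J) ^ (q * p) = ⊥ := by
  have hle : I ≤ ⊤ * I := by
    intro x hx
    simpa using Submodule.mul_mem_mul (Submodule.mem_top (x := (1 : S)) (R := ℤ)) hx
  have h1 : ∀ n : ℕ, (I ⊔ J) ^ n ≤ J ^ n ⊔ ⊤ * I := by
    intro n
    induction n with
    | zero => simp
    | succ n ih =>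
      rw [pow_succ']
      refine (mul_le_mul' le_rfl ih).trans ?_
      rw [Submodule.mul_sup, Submodule.sup_mul]
      refine sup_le (sup_le ?_ ?_) ?_
      · exact ((mul_le_mul' le_rfl le_top).trans (hI.trans hle)).trans le_sup_right
      · rw [← pow_succ']; exact le_sup_left
      · rw [← mul_assoc]
        exact (mul_le_mul' le_top le_rfl).trans le_sup_right
  have h2 : ∀ n : ℕ, (⊤ * I) ^ n ≤ ⊤ * I ^ n := by
    intro n
    induction n with
    | zero =>
      simp
    | succ n ih =>
      rw [pow_succ', pow_succ' I]
      refine (mul_le_mul' le_rfl ih).trans ?_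
      rw [mul_assoc, ← mul_assoc I]
      exact mul_le_mul' le_rfl (mul_le_mul' hI le_rfl)
  have h3 : (I ⊔ J) ^ q ≤ ⊤ * I := by
    have := h1 q
    rwa [hq, bot_sup_eq] at this
  rw [pow_mul, eq_bot_iff]
  refine (pow_le_pow_left' h3 p).trans ((h2 p).trans ?_)
  rw [hp, Submodule.mul_bot]

theorem homInto_nilp {M : Type v} [AddCommGroup M] [Module R M]
    (hproj : IsDirSumSelfProjective R M) (N : Submodule R M)
    (hN : IsLocallyNilpotentSubmodule R N) {k : ℕ} (a : Fin k → M) (ha : ∀ i, a i ∈ N) :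
    ∃ p : ℕ, homInto R (⨆ i, (R ∙ a i : Submodule R M)) ^ p = ⊥ := by
  obtain ⟨l, hl⟩ := hN k a ha
  refine ⟨l + 1, ?_⟩
  rw [eq_bot_iff]
  refine (homInto_pow_le R hproj _ l).trans (iSup_le fun idx => ?_)
  rw [hl idx, homInto_bot]

theorem sup_locallyNilpotent {M : Type v} [AddCommGroup M] [Module R M]
    (hproj : IsDirSumSelfProjective R M) (N L : Submodule R M)
    (hN : IsLocallyNilpotentSubmodule R N) (hL : IsLocallyNilpotentSubmodule R L) :
    IsLocallyNilpotentSubmodule R (N ⊔ L) := by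
  intro k n hn
  choose a ha b hb hab using fun i => Submodule.mem_sup.1 (hn i)
  obtain ⟨p, hp⟩ := homInto_nilp R hproj N hN a ha
  obtain ⟨q, hq⟩ := homInto_nilp R hproj L hL b hb
  set A : Submodule R M := ⨆ i, (R ∙ a i : Submodule R M) with hA
  set B : Submodule R M := ⨆ i, (R ∙ b i : Submodule R M) with hB
  have h0 : homInto R (A ⊔ B) ^ (q * p) = ⊥ := by
    rw [eq_bot_iff, ← pow_sup_eq_bot _ _ (homInto_mul_top R A) p q hp hq]
    exact pow_le_pow_left' (homInto_sup R hproj A B) _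
  refine ⟨q * p, fun idx => ?_⟩
  rw [eq_bot_iff]
  refine (chainProd_le R (A ⊔ B) (q * p) _ fun j => ?_).trans (iSup_le fun f => ?_)
  · rw [Submodule.span_singleton_le_iff_mem, ← hab]
    refine Submodule.add_mem_sup ?_ ?_
    · exact Submodule.mem_iSup_of_mem (idx j) (Submodule.mem_span_singleton_self _)
    · exact Submodule.mem_iSup_of_mem (idx j) (Submodule.mem_span_singleton_self _)
  · obtain ⟨f, hf⟩ := f
    rw [h0, Submodule.mem_bot] at hf
    subst hf
    simp
end

section
/- Let M be a quasi-projective Noetherian left R-module. Then the prime radical of M (the intersection of all prime submodules of M) is a nilpotent submodule. -/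
open Function

universe u v

variable (R : Type u) [Ring R]

section Helpers

variable {M : Type v} [AddCommGroup M] [Module R M]

theorem smulMod_le_iff {A B C : Submodule R M} :
    smulMod R A B ≤ C ↔
      ∀ f : M →ₗ[R] M, (∀ x, f x ∈ B) → ∀ a ∈ A, f a ∈ C := by
  unfold smulMod
  rw [iSup_le_iff]
  constructor
  · intro h f hf a ha
    exact h (f.codRestrict B hf) (Submodule.mem_map_of_mem (f := B.subtype ∘ₗ f.codRestrict B hf) ha)
  · rintro h f _ ⟨a, ha, rfl⟩
    exact h (B.subtype ∘ₗ f) (fun x => (f x).2) a ha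

theorem mem_smulMod {A B : Submodule R M} (f : M →ₗ[R] M) (hf : ∀ x, f x ∈ B)
    {a : M} (ha : a ∈ A) : f a ∈ smulMod R A B :=
  (smulMod_le_iff R).1 le_rfl f hf a ha

theorem smulMod_mono {A A' B B' : Submodule R M} (h : A ≤ A') (h' : B ≤ B') :
    smulMod R A B ≤ smulMod R A' B' :=
  (smulMod_le_iff R).2 fun f hf _ ha => mem_smulMod R f (fun x => h' (hf x)) (h ha)

theorem smulMod_assoc_le (A B C : Submodule R M) :
    smulMod R (smulMod R A B) C ≤ smulMod R A (smulMod R B C) := by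
  rw [smulMod_le_iff]
  intro g hg a ha
  have h : smulMod R A B ≤ (smulMod R A (smulMod R B C)).comap g := by
    rw [smulMod_le_iff]
    intro f hf a ha
    exact mem_smulMod R (g ∘ₗ f) (fun x => mem_smulMod R g hg (hf x)) ha
  exact h ha

theorem spowMod_add_le (I : Submodule R M) (a b : ℕ) :
    spowMod R I (a + b + 1) ≤ smulMod R (spowMod R I a) (spowMod R I b) := by
  induction b with
  | zero => exact le_rfl
  | succ b ih => exact (smulMod_mono R ih le_rfl).trans (smulMod_assoc_le R _ _ _)

theorem IsFullyInvariant.sup' {A B : Submodule R M} (hA : IsFullyInvariant R A)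
    (hB : IsFullyInvariant R B) : IsFullyInvariant R (A ⊔ B) := by
  intro f
  rw [Submodule.map_sup]
  exact sup_le_sup (hA f) (hB f)

theorem exists_lift_sup (hqp : IsQuasiProjective R M) (B N : Submodule R M)
    (h : M →ₗ[R] M) (hh : ∀ x, h x ∈ B ⊔ N) :
    ∃ k : M →ₗ[R] M, ∀ x, k x ∈ B ∧ h x - k x ∈ N := by
  let e := LinearMap.quotientInfEquivSupQuotient B N
  let m : (↥B ⧸ (B ⊓ N).comap B.subtype) →ₗ[R] M ⧸ (B ⊓ N) :=
    Submodule.mapQ _ _ B.subtype le_rfl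
  let q : M →ₗ[R] ↥(B ⊔ N) ⧸ N.comap (B ⊔ N).subtype :=
    (N.comap (B ⊔ N).subtype).mkQ ∘ₗ h.codRestrict _ hh
  obtain ⟨k, hk⟩ := hqp (B ⊓ N) (m ∘ₗ e.symm.toLinearMap ∘ₗ q)
  refine ⟨k, fun x => ?_⟩
  have hx : (B ⊓ N).mkQ (k x) = m (e.symm (q x)) := LinearMap.congr_fun hk x
  obtain ⟨b, hb⟩ := Submodule.mkQ_surjective _ (e.symm (q x))
  have h1 : k x - b ∈ B ⊓ N := by
    rw [← hb] at hx
    exact (Submodule.Quotient.eq _).1 hx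
  have h2 : h x - b ∈ N := by
    have h3 : q x = e (Submodule.Quotient.mk b) := by
      rw [← e.symm_apply_eq]; exact hb.symm
    exact (Submodule.Quotient.eq (N.comap (B ⊔ N).subtype)).1 h3
  constructor
  · have := B.add_mem h1.1 b.2
    simpa using this
  · have := N.sub_mem h2 h1.2
    simpa using this

theorem smulMod_sup_le (hqp : IsQuasiProjective R M) {A B N : Submodule R M}
    (hN : IsFullyInvariant R N) (h : smulMod R A B ≤ N) :
    smulMod R (A ⊔ N) (B ⊔ N) ≤ N := by
  rw [smulMod_le_iff]
  intro f hf x hx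
  obtain ⟨a, ha, n, hn, rfl⟩ := Submodule.mem_sup.1 hx
  obtain ⟨k, hk⟩ := exists_lift_sup R hqp B N f hf
  rw [map_add]
  refine N.add_mem ?_ (hN f (Submodule.mem_map_of_mem hn))
  have := N.add_mem (hk a).2 (h (mem_smulMod R k (fun x => (hk x).1) ha))
  simpa using this

theorem exists_spow_le (hqp : IsQuasiProjective R M) (hnoeth : IsNoetherian R M)
    (N : Submodule R M) :
    IsFullyInvariant R N → ∃ k, spowMod R (primeRadical R M) k ≤ N := by
  induction N using WellFoundedGT.induction with
  | ind N ih =>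
    intro hN
    by_cases hp : IsPrimeSubmodule R N
    · exact ⟨0, sInf_le hp⟩
    by_cases ht : N = ⊤
    · exact ⟨0, ht ▸ le_top⟩
    have : ∃ A B : Submodule R M, IsFullyInvariant R A ∧ IsFullyInvariant R B ∧
        smulMod R A B ≤ N ∧ ¬ A ≤ N ∧ ¬ B ≤ N := by
      by_contra hcon
      refine hp ⟨hN, ht, fun A B hA hB hAB => ?_⟩
      by_contra hor
      rw [not_or] at hor
      exact hcon ⟨A, B, hA, hB, hAB, hor.1, hor.2⟩
    obtain ⟨A, B, hA, hB, hAB, hA', hB'⟩ := this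
    obtain ⟨a, ha⟩ := ih (A ⊔ N) (right_lt_sup.2 hA') (hA.sup' R hN)
    obtain ⟨b, hb⟩ := ih (B ⊔ N) (right_lt_sup.2 hB') (hB.sup' R hN)
    exact ⟨a + b + 1, (spowMod_add_le R _ a b).trans
      ((smulMod_mono R ha hb).trans (smulMod_sup_le R hqp hN hAB))⟩

end Helpers

theorem primeRadical_nilpotent_of_noetherian {M : Type v} [AddCommGroup M]
    [Module R M] (hqp : IsQuasiProjective R M) (hnoeth : IsNoetherian R M) :
    IsNilpotentSubmodule R (primeRadical R M) := by
  obtain ⟨k, hk⟩ := exists_spow_le R hqp hnoeth ⊥ (fun f => by simp)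
  exact ⟨k, le_bot_iff.1 hk⟩
end

section
/- A ring R is semiprime if and only if every free left R-module is a semiprime module, if and only if every projective left R-module is a semiprime module. -/
open Function

universe u v

variable (R : Type u) [Ring R]

/-- `M` is a semiprime module: `0` is a semiprime submodule of `M`. -/
def IsSemiprimeModule (M : Type v) [AddCommGroup M] [Module R M] : Prop :=
  ∀ N : Submodule R M, IsFullyInvariant R N → smulMod R N N = ⊥ → N = ⊥


theorem aux_ring_of_free
    (h : ∀ ι : Type u, IsSemiprimeModule R (ι →₀ R)) (I : Ideal R) (hI : I * I = ⊥) :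
    I = ⊥ := by
  have hmul : ∀ a ∈ I, ∀ b ∈ I, a * b = 0 := by
    intro a ha b hb
    have := Ideal.mul_mem_mul ha hb
    rw [hI] at this
    simpa using this
  set N : Submodule R (PUnit.{u+1} →₀ R) :=
    ⨆ g : R →ₗ[R] (PUnit.{u+1} →₀ R), Submodule.map g I with hN
  have hle : ∀ (g : R →ₗ[R] (PUnit.{u+1} →₀ R)), ∀ a ∈ I, g a ∈ N := by
    intro g a ha
    exact (le_iSup (fun g : R →ₗ[R] (PUnit.{u+1} →₀ R) => Submodule.map g I) g)
      (Submodule.mem_map_of_mem ha)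
  have hkill : ∀ n ∈ N, ∀ a ∈ I, a • n = 0 := by
    intro n hn
    refine Submodule.iSup_induction _ (motive := fun n => ∀ a ∈ I, a • n = 0) hn ?_ ?_ ?_
    · rintro g _ ⟨b, hb, rfl⟩ a ha
      rw [← map_smul, smul_eq_mul, hmul a ha b hb, map_zero]
    · intro a _
      simp
    · intro x y hx hy a ha
      rw [smul_add, hx a ha, hy a ha, add_zero]
  have hbot : N = ⊥ := by
    apply h PUnit N
    · intro f
      rw [Submodule.map_le_iff_le_comap]
      refine iSup_le fun g => ?_
      rintro _ ⟨a, ha, rfl⟩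
      exact hle (f ∘ₗ g) a ha
    · refine iSup_eq_bot.2 fun f => ?_
      rw [eq_bot_iff, Submodule.map_le_iff_le_comap]
      refine iSup_le fun g => ?_
      rintro _ ⟨a, ha, rfl⟩
      have h1 : g a = a • g 1 := by rw [← map_smul, smul_eq_mul, mul_one]
      have h2 := hkill _ (f (g 1)).2 a ha
      simp only [Submodule.mem_comap, Submodule.mem_bot]
      rw [h1, map_smul]
      exact h2
  rw [eq_bot_iff]
  intro a ha
  have := hle (Finsupp.lsingle PUnit.unit) a ha
  rw [hbot] at this
  simpa using this

theorem aux_proj_of_ring (h : ∀ I : Ideal R, I * I = ⊥ → I = ⊥)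
    (P : Type u) [AddCommGroup P] [Module R P] (hP : Module.Projective R P) :
    IsSemiprimeModule R P := by
  intro N _ hNN
  have hk : ∀ (φ : P →ₗ[R] R), ∀ n ∈ N, ∀ m ∈ N, φ n • m = 0 := by
    intro φ n hn m hm
    have h1 := (iSup_eq_bot.1 hNN) (φ.smulRight (⟨m, hm⟩ : N))
    have h2 := Submodule.mem_map_of_mem (f := N.subtype ∘ₗ φ.smulRight (⟨m, hm⟩ : N)) hn
    rw [h1] at h2
    simpa using h2
  have hφ : ∀ (φ : P →ₗ[R] R), ∀ n ∈ N, φ n = 0 := by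
    intro φ n hn
    have h0 : Submodule.map φ N = (⊥ : Ideal R) := by
      apply h
      rw [eq_bot_iff, Ideal.mul_le]
      rintro _ ⟨a, ha, rfl⟩ _ ⟨b, hb, rfl⟩
      rw [← smul_eq_mul, ← map_smul, hk φ a ha b hb, map_zero]
      exact Submodule.zero_mem _
    have := Submodule.mem_map_of_mem (f := φ) hn
    rw [h0] at this
    simpa using this
  obtain ⟨s, hs⟩ := hP.out
  rw [eq_bot_iff]
  intro n hn
  have h0 : s n = 0 := by
    ext p
    exact hφ (Finsupp.lapply p ∘ₗ s) n hn
  have := hs n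
  rw [h0, map_zero] at this
  exact this.symm

theorem semiprime_ring_iff_free_iff_projective :
    ((∀ I : Ideal R, I * I = ⊥ → I = ⊥) ↔
      ∀ ι : Type u, IsSemiprimeModule R (ι →₀ R)) ∧
    ((∀ ι : Type u, IsSemiprimeModule R (ι →₀ R)) ↔
      ∀ (P : Type u) [AddCommGroup P] [Module R P],
        Module.Projective R P → IsSemiprimeModule R P) := by
  refine ⟨⟨fun h ι => aux_proj_of_ring R h _ inferInstance, aux_ring_of_free R⟩,
    fun h P _ _ hP => aux_proj_of_ring R (aux_ring_of_free R h) P hP,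
    fun h ι => h _ inferInstance⟩
end

section
/- For a ring R, the prime radical of R is nilpotent if and only if the prime radical of every free left R-module is a nilpotent submodule, if and only if the prime radical of every projective left R-module is a nilpotent submodule. -/
open Function

universe u v

variable (R : Type u) [Ring R]

/-- The prime radical of the ring `R`: the intersection of all prime (two-sided) ideals. -/
def ringPrimeRadical : Ideal R :=
  sInf {P : Ideal R | P ≠ ⊤ ∧ ∀ I J : Ideal R, I * J ≤ P → I ≤ P ∨ J ≤ P}

section helpers

variable {R}

theorem mem_smul_single {x : PUnit.{u+1} →₀ R} :
    x = x PUnit.unit • Finsupp.single PUnit.unit (1 : R) := by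
  ext; simp

theorem hom_mem_ringPrimeRadical {M : Type v} [AddCommGroup M] [Module R M]
    {x : M} (hx : x ∈ primeRadical R M) (φ : M →ₗ[R] R) : φ x ∈ ringPrimeRadical R := by
  rw [ringPrimeRadical, Submodule.mem_sInf]
  rintro Q ⟨hQ, hp⟩
  let E : Submodule R M := ⨅ ψ : M →ₗ[R] R, Q.comap ψ
  have hE : ∀ y, y ∈ E ↔ ∀ ψ : M →ₗ[R] R, ψ y ∈ Q := by
    intro y; simp [E, Submodule.mem_iInf]
  by_cases hT : E = ⊤
  · exact (hE x).1 (hT ▸ Submodule.mem_top) φ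
  refine (hE x).1 ?_ φ
  refine (Submodule.mem_sInf.1 hx) E ⟨?_, hT, ?_⟩
  · rintro f _ ⟨y, hy, rfl⟩
    exact (hE _).2 fun ψ => (hE y).1 hy (ψ ∘ₗ f)
  · intro A B hA hB hAB
    by_contra! hcon
    obtain ⟨h1, h2⟩ := hcon
    obtain ⟨a, ha, ha'⟩ := SetLike.not_le_iff_exists.1 h1
    obtain ⟨b, hb, hb'⟩ := SetLike.not_le_iff_exists.1 h2
    rw [hE] at ha' hb'
    push Not at ha' hb'
    obtain ⟨α, hα⟩ := ha'
    obtain ⟨β, hβ⟩ := hb'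
    have key : Ideal.span {α a} * Ideal.span {β b} ≤ Q := by
      rw [Ideal.mul_le]
      intro r hr s hs
      obtain ⟨r', rfl⟩ := Ideal.mem_span_singleton'.1 hr
      obtain ⟨s', rfl⟩ := Ideal.mem_span_singleton'.1 hs
      let f : M →ₗ[R] B := (LinearMap.toSpanSingleton R B ⟨s' • b, B.smul_mem _ hb⟩) ∘ₗ α
      have hf : B.subtype (f a) ∈ E := by
        apply hAB
        refine Submodule.mem_iSup_of_mem f ?_
        exact ⟨a, ha, rfl⟩
      have := Q.smul_mem r' ((hE _).1 hf β)
      simpa [f, mul_assoc] using this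
    rcases hp _ _ key with h | h
    · exact hα (h (Ideal.mem_span_singleton_self _))
    · exact hβ (h (Ideal.mem_span_singleton_self _))

theorem hom_mem_pow {M : Type v} [AddCommGroup M] [Module R M] [Module.Projective R M]
    (k : ℕ) : ∀ {x : M}, x ∈ spowMod R (primeRadical R M) k → ∀ (φ : M →ₗ[R] R),
      φ x ∈ ringPrimeRadical R ^ (k + 1) := by
  induction k with
  | zero => 
    intro x hx φ
    rw [Submodule.pow_one]
    exact hom_mem_ringPrimeRadical hx φ
  | succ k ih =>
    intro x hx φ
    suffices h : spowMod R (primeRadical R M) (k+1) ≤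
        Submodule.comap φ (ringPrimeRadical R ^ (k + 1 + 1)) from h hx
    refine iSup_le fun f => ?_
    rintro _ ⟨a, ha, rfl⟩
    obtain ⟨s, hs⟩ := Module.projective_def'.1 (inferInstance : Module.Projective R M)
    have h1 : a = (s a).sum fun m r => r • m := by
      have := LinearMap.congr_fun hs a
      simpa [Finsupp.linearCombination_apply] using this.symm
    rw [Submodule.mem_comap]
    have h2 : φ (((primeRadical R M).subtype ∘ₗ f) a) =
        (s a).sum fun m r => r * φ (f m) := by
      conv_lhs => rw [h1]
      simp [Finsupp.sum, map_sum]
    rw [h2, Submodule.pow_succ]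
    refine Submodule.sum_mem _ fun m _ => ?_
    exact Ideal.mul_mem_mul (ih ha (Finsupp.lapply m ∘ₗ s))
      (hom_mem_ringPrimeRadical (f m).2 φ)

theorem single_mem_primeRadical {a : R} (ha : a ∈ ringPrimeRadical R) :
    Finsupp.single PUnit.unit a ∈ primeRadical R (PUnit.{u+1} →₀ R) := by
  rw [primeRadical, Submodule.mem_sInf]
  rintro P ⟨hP, hT, hp⟩
  let L : R →ₗ[R] (PUnit.{u+1} →₀ R) := Finsupp.lsingle PUnit.unit
  refine (Submodule.mem_sInf.1 ha) (P.comap L) ⟨?_, ?_⟩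
  · intro h
    apply hT
    rw [eq_top_iff]
    rintro x -
    rw [mem_smul_single (x := x)]
    refine P.smul_mem _ ?_
    have : (1 : R) ∈ P.comap L := h ▸ Submodule.mem_top
    exact this
  · intro I J hIJ
    let C : Ideal R → Submodule R (PUnit.{u+1} →₀ R) := fun I =>
      ⨆ f : Module.End R (PUnit.{u+1} →₀ R), (Submodule.map L I).map f
    have hle : ∀ I, Submodule.map L I ≤ C I := fun I =>
      le_trans (by rw [show (1 : Module.End R (PUnit.{u+1} →₀ R)) = LinearMap.id from rfl,
        Submodule.map_id]) (le_iSup (fun f : Module.End R (PUnit.{u+1} →₀ R) => (Submodule.map L I).map f) 1)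
    have hC : ∀ I, IsFullyInvariant R (C I) := by
      intro I g
      rw [Submodule.map_iSup]
      refine iSup_le fun f => ?_
      rw [← Submodule.map_comp]
      exact le_iSup (fun f : Module.End R (PUnit.{u+1} →₀ R) => (Submodule.map L I).map f) (g ∘ₗ f)
    have hs : smulMod R (C I) (C J) ≤ P := by
      refine iSup_le fun g => ?_
      rw [Submodule.map_iSup]
      refine iSup_le fun h => ?_
      rintro _ ⟨_, ⟨_, ⟨i, hi, rfl⟩, rfl⟩, rfl⟩
      have e1 : L i = i • L 1 := by simp [L]
      rw [e1, map_smul, map_smul]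
      have hm : ((C J).subtype ∘ₗ g) (h (L 1)) ∈ C J := (g (h (L 1))).2
      suffices hh : ∀ y ∈ C J, i • y ∈ P from hh _ hm
      intro y hy
      refine Submodule.iSup_induction _ (motive := fun y => i • y ∈ P) hy ?_ ?_ ?_
      · rintro f _ ⟨_, ⟨j, hj, rfl⟩, rfl⟩
        rw [← map_smul, ← map_smul]
        refine hP f ⟨_, ?_, rfl⟩
        exact hIJ (Ideal.mul_mem_mul hi hj)
      · simp
      · intro y z hy hz; rw [smul_add]; exact P.add_mem hy hz
    rcases hp _ _ (hC I) (hC J) hs with h | h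
    · exact Or.inl (Submodule.map_le_iff_le_comap.1 ((hle I).trans h))
    · exact Or.inr (Submodule.map_le_iff_le_comap.1 ((hle J).trans h))

theorem single_mem_spowMod (k : ℕ) : ringPrimeRadical R ^ (k + 1) ≤
    (spowMod R (primeRadical R (PUnit.{u+1} →₀ R)) k).comap (Finsupp.lsingle PUnit.unit) := by
  induction k with
  | zero => intro a ha; exact single_mem_primeRadical (by rwa [Submodule.pow_one] at ha)
  | succ k ih =>
    rw [Submodule.pow_succ, Ideal.mul_le]
    intro a ha b hb
    let N := primeRadical R (PUnit.{u+1} →₀ R)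
    let f : (PUnit.{u+1} →₀ R) →ₗ[R] N :=
      (LinearMap.toSpanSingleton R N ⟨_, single_mem_primeRadical hb⟩) ∘ₗ
        Finsupp.lapply PUnit.unit
    refine Submodule.mem_iSup_of_mem f ?_
    refine ⟨Finsupp.single PUnit.unit a, ih ha, ?_⟩
    simp [f, N]

end helpers

theorem primeRadical_nilpotent_iff_free_iff_projective :
    ((∃ n : ℕ, (ringPrimeRadical R) ^ (n + 1) = ⊥) ↔
      ∀ ι : Type u, IsNilpotentSubmodule R (primeRadical R (ι →₀ R))) ∧
    ((∀ ι : Type u, IsNilpotentSubmodule R (primeRadical R (ι →₀ R))) ↔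
      ∀ (P : Type u) [AddCommGroup P] [Module R P],
        Module.Projective R P → IsNilpotentSubmodule R (primeRadical R P)) := by
  have h13 : (∃ n : ℕ, (ringPrimeRadical R) ^ (n + 1) = ⊥) →
      ∀ (P : Type u) [AddCommGroup P] [Module R P],
        Module.Projective R P → IsNilpotentSubmodule R (primeRadical R P) := by
    rintro ⟨n, hn⟩ P _ _ hP
    refine ⟨n, (Submodule.eq_bot_iff _).2 fun x hx => ?_⟩
    have h0 : ∀ φ : P →ₗ[R] R, φ x = 0 := fun φ => by
      have := hom_mem_pow n hx φ
      rwa [hn] at this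
    obtain ⟨s, hs⟩ := Module.projective_def'.1 hP
    have h1 : s x = 0 := by
      ext m; exact h0 (Finsupp.lapply m ∘ₗ s)
    have := LinearMap.congr_fun hs x
    simpa [h1] using this.symm
  have h32 : (∀ (P : Type u) [AddCommGroup P] [Module R P],
        Module.Projective R P → IsNilpotentSubmodule R (primeRadical R P)) →
      ∀ ι : Type u, IsNilpotentSubmodule R (primeRadical R (ι →₀ R)) :=
    fun h ι => h _ inferInstance
  have h21 : (∀ ι : Type u, IsNilpotentSubmodule R (primeRadical R (ι →₀ R))) →
      ∃ n : ℕ, (ringPrimeRadical R) ^ (n + 1) = ⊥ := by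
    intro h
    obtain ⟨k, hk⟩ := h PUnit.{u+1}
    refine ⟨k, (Submodule.eq_bot_iff _).2 fun a ha => ?_⟩
    have := single_mem_spowMod k ha
    rw [hk] at this
    simpa using this
  exact ⟨⟨fun h => h32 (h13 h), h21⟩, ⟨fun h => h13 (h21 h), h32⟩⟩
end

section
/- If a left R-module M satisfies the ascending chain condition on annihilators, then S = End_R(M) satisfies the ascending chain condition on right annihilators. -/
open Function

universe u v

variable (R : Type u) [Ring R]

/-- Right annihilator of a set of endomorphisms in `S = End_R(M)`. -/
def rAnnS {M : Type v} [AddCommGroup M] [Module R M]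
    (X : Set (Module.End R M)) : Set (Module.End R M) :=
  {s | ∀ x ∈ X, x * s = 0}

theorem acc_annihilators_endomorphism_ring {M : Type v} [AddCommGroup M]
    [Module R M] (h : AccOnAnnihilators R M) :
    ∀ c : ℕ → Set (Module.End R M),
      (∀ i, rAnnS R (c i) ⊆ rAnnS R (c (i + 1))) →
        ∃ n : ℕ, ∀ m : ℕ, n ≤ m → rAnnS R (c m) = rAnnS R (c n) := by
  intro c hc
  let L : ℕ → Set (Module.End R M) := fun i => {t | ∀ s ∈ rAnnS R (c i), t * s = 0}
  have memK : ∀ (Y : Set (Module.End R M)) (m : M),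
      m ∈ kerInt R Y ↔ ∀ f ∈ Y, f m = 0 := by
    intro Y m
    simp [kerInt, Submodule.mem_iInf]
  have key : ∀ i s, s ∈ rAnnS R (c i) ↔ ∀ m, s m ∈ kerInt R (L i) := by
    intro i s
    constructor
    · intro hs m
      rw [memK]
      intro f hf
      exact LinearMap.congr_fun (hf s hs) m
    · intro hs x hx
      refine LinearMap.ext fun m => ?_
      exact (memK _ _).1 (hs m) x (fun t ht => ht x hx)
  obtain ⟨n, hn⟩ := h L (by
    intro i m hm
    rw [memK] at hm ⊢
    intro f hf
    exact hm f (fun s hs => hf s (hc i hs)))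
  refine ⟨n, fun m hm => Set.ext fun s => ?_⟩
  rw [key, key, hn m hm]
end

section
/- Suppose M is M^(Λ)-projective for every index set Λ. Then: (1) for any subset X ⊆ M, l_S(⋂_{f∈l_S(X)} Ker f) = l_S(X); (2) for any subset Y ⊆ End_R(M), ⋂_{f∈Y} Ker f = ⋂{Ker g | g ∈ l_S(⋂_{f∈Y} Ker f)}; (3) M satisfies acc on annihilators if and only if the set {l_S(X) | X ⊆ M} satisfies dcc. -/
open Function

universe u v

variable (R : Type u) [Ring R]

/-- `l_S(X) = {f ∈ S ∣ f(X) = 0}` for `X ⊆ M`. -/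
def lS {M : Type v} [AddCommGroup M] [Module R M] (X : Set M) :
    Set (Module.End R M) :=
  {f | ∀ x ∈ X, f x = 0}

theorem lS_kerInt_properties {M : Type v} [AddCommGroup M] [Module R M]
    (hproj : IsDirSumSelfProjective R M) :
    (∀ X : Set M, lS R (↑(kerInt R (lS R X)) : Set M) = lS R X) ∧
    (∀ Y : Set (Module.End R M),
      kerInt R Y = kerInt R (lS R (↑(kerInt R Y) : Set M))) ∧
    (AccOnAnnihilators R M ↔
      ∀ c : ℕ → Set M, (∀ i, lS R (c (i + 1)) ⊆ lS R (c i)) →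
        ∃ n : ℕ, ∀ m : ℕ, n ≤ m → lS R (c m) = lS R (c n)) := by
  have hk : ∀ (Y : Set (Module.End R M)) (x : M),
      x ∈ kerInt R Y ↔ ∀ f ∈ Y, f x = 0 := by
    intro Y x
    simp [kerInt, Submodule.mem_iInf]
  have h1 : ∀ X : Set M, lS R (↑(kerInt R (lS R X)) : Set M) = lS R X := by
    intro X
    apply Set.Subset.antisymm
    · intro f hf x hx
      exact hf x ((hk _ x).2 fun g hg => hg x hx)
    · intro f hf x hx
      exact (hk _ x).1 hx f hf
  have h2 : ∀ Y : Set (Module.End R M),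
      kerInt R Y = kerInt R (lS R (↑(kerInt R Y) : Set M)) := by
    intro Y
    apply le_antisymm
    · intro x hx
      exact (hk _ x).2 fun g hg => hg x hx
    · intro x hx
      exact (hk _ x).2 fun f hf => (hk _ x).1 hx f fun y hy => (hk _ y).1 hy f hf
  refine ⟨h1, h2, ?_, ?_⟩
  · intro hacc c hc
    obtain ⟨n, hn⟩ := hacc (fun i => lS R (c i)) (fun i x hx =>
      (hk _ x).2 fun f hf => (hk _ x).1 hx f (hc i hf))
    refine ⟨n, fun m hm => ?_⟩
    have := hn m hm
    rw [← h1 (c m), this, h1]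
  · intro hdcc c hc
    obtain ⟨n, hn⟩ := hdcc (fun i => (↑(kerInt R (c i)) : Set M))
      (fun i f hf x hx => hf x (hc i hx))
    refine ⟨n, fun m hm => ?_⟩
    have := hn m hm
    rw [h2 (c m), this, ← h2]
end

section
/- Suppose M is M^(Λ)-projective for every index set Λ and M is retractable. Then for any submodule N ≤ M, both M/ann_M^r(N) and M/ann_M(N) are retractable. -/
open Function

universe u v

variable (R : Type u) [Ring R]

theorem aux_lift {M : Type v} [AddCommGroup M] [Module R M]
    (hproj : IsDirSumSelfProjective R M) (ι : Type v) (p : (ι →₀ M) →ₗ[R] M)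
    (K : Submodule R (ι →₀ M)) (f : M →ₗ[R] M) (hf : ∀ m, f m ∈ K.map p) :
    ∃ h : M →ₗ[R] (ι →₀ M), (∀ m, h m ∈ K) ∧ ∀ m, p (h m) = f m := by
  let L : Submodule R (ι →₀ M) := K ⊓ LinearMap.ker p
  let q : K →ₗ[R] M := p ∘ₗ K.subtype
  let j : K →ₗ[R] (ι →₀ M) ⧸ L := L.mkQ ∘ₗ K.subtype
  have hj : LinearMap.ker q ≤ LinearMap.ker j := by
    intro x hx
    have hx' : p x = 0 := hx
    have : L.mkQ (x : ι →₀ M) = 0 := by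
      rw [Submodule.mkQ_apply, Submodule.Quotient.mk_eq_zero]
      exact ⟨x.2, hx'⟩
    exact this
  have hfr : ∀ m, f m ∈ LinearMap.range q := by
    intro m
    obtain ⟨k, hk, e⟩ := hf m
    exact ⟨⟨k, hk⟩, e⟩
  let g : M →ₗ[R] (ι →₀ M) ⧸ L :=
    ((LinearMap.ker q).liftQ j hj) ∘ₗ q.quotKerEquivRange.symm.toLinearMap ∘ₗ
      (f.codRestrict (LinearMap.range q) hfr)
  obtain ⟨h, hh⟩ := hproj ι L g
  have key : ∀ m, h m ∈ K ∧ p (h m) = f m := by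
    intro m
    obtain ⟨k, e⟩ := hfr m
    have h1 : q.quotKerEquivRange.symm (f.codRestrict (LinearMap.range q) hfr m)
        = (LinearMap.ker q).mkQ k := by
      rw [LinearEquiv.symm_apply_eq]
      apply Subtype.ext
      exact e.symm
    have h2 : g m = L.mkQ (k : ι →₀ M) := by
      change ((LinearMap.ker q).liftQ j hj) (q.quotKerEquivRange.symm
        (f.codRestrict (LinearMap.range q) hfr m)) = _
      rw [h1]
      rfl
    have h3 : L.mkQ (h m) = L.mkQ (k : ι →₀ M) := by
      rw [← h2, ← hh]; rfl
    have h4 : h m - k ∈ L := (Submodule.Quotient.eq L).1 h3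
    have h5 : p (h m - k) = 0 := h4.2
    refine ⟨?_, ?_⟩
    · have := K.add_mem h4.1 k.2
      simpa using this
    · rw [map_sub, sub_eq_zero] at h5
      rw [h5]; exact e
  exact ⟨h, fun m => (key m).1, fun m => (key m).2⟩

theorem aux_lift_one {M : Type v} [AddCommGroup M] [Module R M]
    (hproj : IsDirSumSelfProjective R M) (p : M →ₗ[R] M)
    (K : Submodule R M) (f : M →ₗ[R] M) (hf : ∀ m, f m ∈ K.map p) :
    ∃ h : M →ₗ[R] M, (∀ m, h m ∈ K) ∧ ∀ m, p (h m) = f m := by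
  let l : (PUnit.{v+1} →₀ M) →ₗ[R] M := Finsupp.lapply PUnit.unit
  obtain ⟨h, h1, h2⟩ := aux_lift R hproj PUnit (p ∘ₗ l) (K.comap l) f (by
    intro m
    obtain ⟨k, hk, e⟩ := hf m
    refine ⟨Finsupp.single PUnit.unit k, ?_, ?_⟩
    · simpa [l] using hk
    · simpa [l] using e)
  exact ⟨l ∘ₗ h, h1, h2⟩

theorem aux_smul {M : Type v} [AddCommGroup M] [Module R M] (N K : Submodule R M) :
    smulMod R N K = ⊥ ↔ ∀ f : M →ₗ[R] M, (∀ m, f m ∈ K) → ∀ n ∈ N, f n = 0 := by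
  unfold smulMod
  rw [iSup_eq_bot]
  constructor
  · intro H f hf n hn
    have := H (f.codRestrict K hf)
    rw [Submodule.eq_bot_iff] at this
    exact this _ ⟨n, hn, rfl⟩
  · intro H f
    rw [Submodule.eq_bot_iff]
    rintro _ ⟨n, hn, rfl⟩
    exact H (K.subtype ∘ₗ f) (fun m => (f m).2) n hn

theorem aux_retract {M : Type v} [AddCommGroup M] [Module R M] (A : Submodule R M)
    (hA : ∀ g : M →ₗ[R] M, ∀ a ∈ A, g a ∈ A)
    (H : ∀ K : Submodule R M, ¬ K ≤ A →
      ∃ h : M →ₗ[R] M, (∀ m, h m ∈ K) ∧ ∃ m, h m ∉ A) :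
    IsRetractable R (M ⧸ A) := by
  intro K hK
  obtain ⟨h, h1, m, hm⟩ := H (K.comap A.mkQ) (by
    intro hle
    apply hK
    rw [Submodule.eq_bot_iff]
    intro x hx
    obtain ⟨y, rfl⟩ := A.mkQ_surjective x
    exact (Submodule.Quotient.mk_eq_zero A).2 (hle hx))
  refine ⟨(A.mapQ A h (fun a ha => hA h a ha)).codRestrict K ?_, ?_⟩
  · intro x
    obtain ⟨y, rfl⟩ := A.mkQ_surjective x
    exact h1 y
  · intro h0
    apply hm
    have := congrArg Subtype.val (LinearMap.congr_fun h0 (A.mkQ m))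
    exact (Submodule.Quotient.mk_eq_zero A).1 this

theorem aux_rann {M : Type v} [AddCommGroup M] [Module R M]
    (hproj : IsDirSumSelfProjective R M) (N : Submodule R M) :
    smulMod R N (rannIn R N) = ⊥ := by
  rw [aux_smul]
  intro f hf n hn
  let ι : Type v := {K : Submodule R M // smulMod R N K = ⊥}
  let p : (ι →₀ M) →ₗ[R] M := Finsupp.lsum ℕ (fun _ : ι => (LinearMap.id : M →ₗ[R] M))
  let T : Submodule R (ι →₀ M) := ⨅ i : ι, (i.1).comap (Finsupp.lapply i)
  have hle : rannIn R N ≤ T.map p := by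
    refine sSup_le ?_
    intro K hK k hk
    refine ⟨Finsupp.single (⟨K, hK⟩ : ι) k, ?_, ?_⟩
    · simp only [T, SetLike.mem_coe, Submodule.mem_iInf, Submodule.mem_comap,
        Finsupp.lapply_apply]
      intro i
      by_cases hi : (⟨K, hK⟩ : ι) = i
      · subst hi
        simpa using hk
      · rw [Finsupp.single_eq_of_ne (Ne.symm hi)]
        exact Submodule.zero_mem _
    · simp [p]
  obtain ⟨h, h1, h2⟩ := aux_lift R hproj ι p T f (fun m => hle (hf m))
  have h0 : h n = 0 := by
    ext i
    have := (aux_smul R N i.1).1 i.2 (Finsupp.lapply i ∘ₗ h)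
      (fun m => (Submodule.mem_iInf _).1 (h1 m) i) n hn
    exact this
  rw [← h2, h0, map_zero]

theorem quotient_retractable {M : Type v} [AddCommGroup M] [Module R M]
    (hproj : IsDirSumSelfProjective R M) (hret : IsRetractable R M)
    (N : Submodule R M) :
    IsRetractable R (M ⧸ rannIn R N) ∧ IsRetractable R (M ⧸ annIn R N) := by
  constructor
  · have hz := aux_rann R hproj N
    refine aux_retract R _ ?_ ?_
    · intro g a ha
      have : smulMod R N ((rannIn R N).map g) = ⊥ := by
        rw [aux_smul]
        intro f hf n hn
        obtain ⟨h, h1, h2⟩ := aux_lift_one R hproj g _ f hf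
        rw [← h2, (aux_smul R N _).1 hz h h1 n hn, map_zero]
      exact (le_sSup this : _ ≤ rannIn R N) ⟨a, ha, rfl⟩
    · intro K hK
      by_contra hcon
      push Not at hcon
      apply hK
      refine le_sSup ?_
      change smulMod R N K = ⊥
      rw [aux_smul]
      intro f hf
      exact (aux_smul R N _).1 hz f (hcon f hf)
  · have hmem : ∀ x, x ∈ annIn R N ↔ ∀ f : M →ₗ[R] ↥N, f x = 0 := by
      intro x
      simp [annIn, Submodule.mem_iInf]
    refine aux_retract R _ ?_ ?_
    · intro g a ha
      rw [hmem] at ha ⊢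
      intro f
      exact ha (f ∘ₗ g)
    · intro K hK
      obtain ⟨x, hx, hxA⟩ := Set.not_subset.1 hK
      have hxA' : ¬ x ∈ annIn R N := hxA
      rw [hmem] at hxA'
      push Not at hxA'
      obtain ⟨f, hf⟩ := hxA'
      let f' : M →ₗ[R] M := N.subtype ∘ₗ f
      obtain ⟨g, hg⟩ := hret (K.map f') (by
        intro h0
        rw [Submodule.eq_bot_iff] at h0
        exact hf (Subtype.ext (h0 _ ⟨x, hx, rfl⟩)))
      obtain ⟨h, h1, h2⟩ := aux_lift_one R hproj f' K ((K.map f').subtype ∘ₗ g)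
        (fun m => (g m).2)
      refine ⟨h, h1, ?_⟩
      by_contra hcon
      push Not at hcon
      apply hg
      ext m
      have e := (hmem _).1 (hcon m) f
      have e2 : f' (h m) = 0 := congrArg Subtype.val e
      rw [h2] at e2
      exact e2
end
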